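/- arXiv:math-ph/0701027 — 2 statements merged into one kernel-verified Lean document; each statement's English description precedes it below -/
import Mathlib

section
/- Let n ≥ 4 and let (a_1(t), …, a_{n+1}(t), b_1(t), …, b_n(t)) be a differentiable solution of the Kozlov–Treshchev system in Flaschka variables: ȧ_i = a_i(b_{i+1} − b_i) for i = 1, …, n−1; ȧ_n = −a_n(b_{n−1} + b_n); ȧ_{n+1} = a_{n+1} b_1; ḃ_1 = 2a_1² − a_{n+1}² − 4a_{n+1}⁴; ḃ_i = 2(a_i² − a_{i−1}²) for i = 2, …, n−2 and i = n; ḃ_{n−1} = 2(a_n² + a_{n−1}² − a_{n−2}²). Let L be the 2n×2n symmetric matrix with diagonal (b_1, …, b_n, −b_n, …, −b_1), superдiagonal entries L_{i,i+1} = a_i for i = 1, …, n−1, L_{n,n+1} = 0, L_{n+j,n+j+1} = −a_{n−j} for j = 1, …, n−1, additional entries L_{n−1,n+1} = L_{n+1,n−1} = −a_n, L_{n,n+2} = L_{n+2,n} = a_n, and all other entries zero, and let B be its skew-symmetric part. Define the 2n×2n complex matrices A and C by: A = L² except A_{11} = A_{2n,2n} = a_1² + b_1² + a_{n+1}² + 2a_{n+1}⁴,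 A_{12} = A_{2n,2n−1} = a_1(b_1 + b_2 + √2 i a_{n+1}²), A_{21} = A_{2n−1,2n} = a_1(b_1 + b_2 − √2 i a_{n+1}²); and C = B except C_{11} = C_{2n,2n} = √2 i a_{n+1}². Then A'(t) = C(t)A(t) − A(t)C(t) for all t. -/
/-- The symmetric `2n×2n` Lax matrix `L` (1-based indices `i' = i+1, j' = j+1`):
diagonal `(b_1, …, b_n, −b_n, …, −b_1)`, superdiagonal entries `L_{i,i+1} = a_i`
for `i = 1, …, n−1`, `L_{n,n+1} = 0`, `L_{n+j,n+j+1} = −a_{n−j}` for `j = 1, …, n−1`,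
additional entries `L_{n−1,n+1} = L_{n+1,n−1} = −a_n`, `L_{n,n+2} = L_{n+2,n} = a_n`,
and all other entries zero. -/
def DnLax (n : ℕ) (a b : ℕ → ℝ) : Matrix (Fin (2 * n)) (Fin (2 * n)) ℝ :=
  Matrix.of fun i j =>
    let i' := (i : ℕ) + 1
    let j' := (j : ℕ) + 1
    if i' = j' then (if i' ≤ n then b i' else -b (2 * n + 1 - i'))
    else if j' = i' + 1 then
      (if i' ≤ n - 1 then a i' else if i' = n then 0 else -a (2 * n - i'))
    else if i' = j' + 1 then
      (if j' ≤ n - 1 then a j' else if j' = n then 0 else -a (2 * n - j'))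
    else if i' = n - 1 ∧ j' = n + 1 then -a n
    else if i' = n + 1 ∧ j' = n - 1 then -a n
    else if i' = n ∧ j' = n + 2 then a n
    else if i' = n + 2 ∧ j' = n then a n
    else 0

/-- The skew-symmetric part of a matrix: `B_{ij} = L_{ij}` for `i < j`,
`B_{ij} = −L_{ij}` for `i > j`, `B_{ii} = 0`. -/
def skewPart {N : ℕ} (L : Matrix (Fin N) (Fin N) ℝ) : Matrix (Fin N) (Fin N) ℝ :=
  Matrix.of fun i j => if (i : ℕ) < j then L i j else if (j : ℕ) < i then -L i j else 0

/-- The `2n×2n` complex matrix `A`: equal to `L²` except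
`A_{11} = A_{2n,2n} = a_1² + b_1² + a_{n+1}² + 2a_{n+1}⁴`,
`A_{12} = A_{2n,2n−1} = a_1(b_1 + b_2 + √2 i a_{n+1}²)`,
`A_{21} = A_{2n−1,2n} = a_1(b_1 + b_2 − √2 i a_{n+1}²)` (1-based indices). -/
noncomputable def KTA (n : ℕ) (a b : ℕ → ℝ) : Matrix (Fin (2 * n)) (Fin (2 * n)) ℂ :=
  Matrix.of fun i j =>
    let i' := (i : ℕ) + 1
    let j' := (j : ℕ) + 1
    if i' = 1 ∧ j' = 1 ∨ i' = 2 * n ∧ j' = 2 * n then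
      (((a 1) ^ 2 + (b 1) ^ 2 + (a (n + 1)) ^ 2 + 2 * (a (n + 1)) ^ 4 : ℝ) : ℂ)
    else if i' = 1 ∧ j' = 2 ∨ i' = 2 * n ∧ j' = 2 * n - 1 then
      ((a 1 : ℝ) : ℂ) * (((b 1 : ℝ) : ℂ) + ((b 2 : ℝ) : ℂ)
        + ((Real.sqrt 2 : ℝ) : ℂ) * Complex.I * ((a (n + 1) : ℝ) : ℂ) ^ 2)
    else if i' = 2 ∧ j' = 1 ∨ i' = 2 * n - 1 ∧ j' = 2 * n then
      ((a 1 : ℝ) : ℂ) * (((b 1 : ℝ) : ℂ) + ((b 2 : ℝ) : ℂ)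
        - ((Real.sqrt 2 : ℝ) : ℂ) * Complex.I * ((a (n + 1) : ℝ) : ℂ) ^ 2)
    else (((DnLax n a b * DnLax n a b) i j : ℝ) : ℂ)

/-- The `2n×2n` complex matrix `C`: equal to the skew-symmetric part `B` of `L` except
`C_{11} = C_{2n,2n} = √2 i a_{n+1}²` (1-based indices). -/
noncomputable def KTC (n : ℕ) (a b : ℕ → ℝ) : Matrix (Fin (2 * n)) (Fin (2 * n)) ℂ :=
  Matrix.of fun i j =>
    let i' := (i : ℕ) + 1
    let j' := (j : ℕ) + 1
    if i' = 1 ∧ j' = 1 ∨ i' = 2 * n ∧ j' = 2 * n then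
      ((Real.sqrt 2 : ℝ) : ℂ) * Complex.I * ((a (n + 1) : ℝ) : ℂ) ^ 2
    else ((skewPart (DnLax n a b) i j : ℝ) : ℂ)

section PairedShift

variable {R : Type*} [CommRing R]

/-- Entries of the strictly upper triangular part of a `D_n`-type Lax matrix (0-based): weights
`v i` at `(i, i + 1)`, together with `-q` at `(n - 2, n)` and `q` at `(n - 1, n + 1)`. -/
def upperEntry (n : ℕ) (v : ℕ → R) (q : R) (i j : ℕ) : R :=
  (if j = i + 1 then v i else 0) + (if i + 2 = n ∧ j = n then -q else 0)
    + (if i + 1 = n ∧ j = n + 1 then q else 0)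

theorem sum_upperEntry_row_mul {n : ℕ} (hn : 2 ≤ n) (v : ℕ → R) (q : R) (f : ℕ → R) (i : ℕ) :
    ∑ k : Fin (2 * n), upperEntry n v q i k * f k
      = (if i + 1 < 2 * n then v i * f (i + 1) else 0) + (if i + 2 = n then -q * f n else 0)
        + (if i + 1 = n then q * f (n + 1) else 0) := by
  rw [Fin.sum_univ_eq_sum_range (fun k => upperEntry n v q i k * f k)]
  simp only [upperEntry, add_mul, ite_mul, zero_mul, Finset.sum_add_distrib, ite_and]
  have h1 : n < 2 * n := by omega
  have h2 : n + 1 < 2 * n := by omega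
  congr 1
  · congr 1
    · simp
    · split_ifs <;> simp [h1]
  · split_ifs <;> simp [h2]

theorem sum_upperEntry_col_mul {n : ℕ} (hn : 2 ≤ n) (v : ℕ → R) (q : R) (f : ℕ → R) {j : ℕ}
    (hj : j < 2 * n) :
    ∑ k : Fin (2 * n), upperEntry n v q k j * f k
      = (if 1 ≤ j then v (j - 1) * f (j - 1) else 0) + (if j = n then -q * f (n - 2) else 0)
        + (if j = n + 1 then q * f (n - 1) else 0) := by
  rw [Fin.sum_univ_eq_sum_range (fun k => upperEntry n v q k j * f k)]
  simp only [upperEntry, add_mul, ite_mul, zero_mul, Finset.sum_add_distrib]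
  congr 1
  · congr 1
    · split_ifs with h
      · rw [Finset.sum_eq_single (j - 1)]
        · rw [if_pos (by omega)]
        · intro k _ hk
          rw [if_neg (by omega)]
        · simp; omega
      · refine Finset.sum_eq_zero fun k _ => if_neg (by omega)
    · split_ifs with h
      · rw [Finset.sum_eq_single (n - 2)]
        · rw [if_pos (by omega)]
        · intro k _ hk
          rw [if_neg (by omega)]
        · simp; omega
      · refine Finset.sum_eq_zero fun k _ => if_neg (by omega)
  · split_ifs with h
    · rw [Finset.sum_eq_single (n - 1)]
      · rw [if_pos (by omega)]
      · intro k _ hk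
        rw [if_neg (by omega)]
      · simp; omega
    · refine Finset.sum_eq_zero fun k _ => if_neg (by omega)

/-- The matrix with entries `upperEntry`. -/
def upperMatrix (n : ℕ) (v : ℕ → R) (q : R) : Matrix (Fin (2 * n)) (Fin (2 * n)) R :=
  Matrix.of fun i j => upperEntry n v q i j

/-- The diagonal of the commutator of an `upperMatrix` with its transpose. -/
def commDiag (n : ℕ) (v : ℕ → R) (q : R) (i : ℕ) : R :=
  (if i + 1 < 2 * n then v i ^ 2 else 0) - (if 1 ≤ i then v (i - 1) ^ 2 else 0)
    + (if i + 2 = n ∨ i + 1 = n then q ^ 2 else 0) - (if i = n ∨ i = n + 1 then q ^ 2 else 0)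

open Matrix in
theorem upperMatrix_comm_transpose (m : ℕ) (v : ℕ → R) (q : R)
    (h0 : v (m + 1) = 0) (h1 : v (m + 2) = -v m) :
    upperMatrix (m + 2) v q * (upperMatrix (m + 2) v q)ᵀ
      - (upperMatrix (m + 2) v q)ᵀ * upperMatrix (m + 2) v q
      = diagonal fun i : Fin (2 * (m + 2)) => commDiag (m + 2) v q i := by
  ext i j
  obtain ⟨i, hi⟩ := i
  obtain ⟨j, hj⟩ := j
  simp only [Matrix.sub_apply, mul_apply, transpose_apply, upperMatrix, of_apply, diagonal_apply,
    Fin.mk.injEq]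
  rw [sum_upperEntry_row_mul (by omega) v q (fun k => upperEntry (m + 2) v q j k),
    sum_upperEntry_col_mul (by omega) v q (fun k => upperEntry (m + 2) v q k j) hi]
  simp only [upperEntry, commDiag]
  rcases (by omega : i = j ∨ j ≠ i) with rfl | h'
  · rcases (by omega : i < m ∨ m = i ∨ m + 1 = i ∨ m + 2 = i ∨ m + 3 = i ∨ m + 3 < i) with
      h | rfl | rfl | rfl | rfl | h <;>
    simp (disch := omega) [if_pos, if_neg, h0, h1] <;> ring_nf
  · rcases (by omega : i < m ∨ m = i ∨ m + 1 = i ∨ m + 2 = i ∨ m + 3 = i ∨ m + 3 < i) with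
      h | rfl | rfl | rfl | rfl | h <;>
    rcases (by omega : j < m ∨ m = j ∨ m + 1 = j ∨ m + 2 = j ∨ m + 3 = j ∨ m + 3 < j) with
      h'' | rfl | rfl | rfl | rfl | h'' <;>
    first
    | omega
    | simp (disch := omega) [if_pos, if_neg, h0, h1, h']; done
    | simp (disch := omega) [if_pos, h0, h1]; ring


/-- Entries of the symmetric matrix with diagonal `d` and upper triangular part `upperEntry`. -/
def symEntry (n : ℕ) (d v : ℕ → R) (q : R) (i j : ℕ) : R :=
  (if i = j then d i else 0) + upperEntry n v q i j + upperEntry n v q j i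

theorem sum_symEntry_mul {n : ℕ} (hn : 2 ≤ n) (d v : ℕ → R) (q : R) (f : ℕ → R) {i : ℕ}
    (hi : i < 2 * n) :
    ∑ k : Fin (2 * n), symEntry n d v q i k * f k
      = d i * f i
        + ((if i + 1 < 2 * n then v i * f (i + 1) else 0) + (if i + 2 = n then -q * f n else 0)
          + (if i + 1 = n then q * f (n + 1) else 0))
        + ((if 1 ≤ i then v (i - 1) * f (i - 1) else 0) + (if i = n then -q * f (n - 2) else 0)
          + (if i = n + 1 then q * f (n - 1) else 0)) := by
  simp only [symEntry, add_mul, Finset.sum_add_distrib]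
  rw [sum_upperEntry_row_mul hn, sum_upperEntry_col_mul hn v q f hi,
    Fin.sum_univ_eq_sum_range (fun k => (if i = k then d i else 0) * f k)]
  simp [hi]

/-- Entries of a matrix supported near the corners `(0, 0)` and `(2n - 1, 2n - 1)`. -/
def cornerEntry (n : ℕ) (p x : R) (i j : ℕ) : R :=
  if i = 0 ∧ j = 0 ∨ i + 1 = 2 * n ∧ j + 1 = 2 * n then p
  else if i = 0 ∧ j = 1 ∨ i + 1 = 2 * n ∧ j + 2 = 2 * n then x
  else if i = 1 ∧ j = 0 ∨ i + 2 = 2 * n ∧ j + 1 = 2 * n then -x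
  else 0

set_option maxHeartbeats 2000000 in
theorem cornerEntry_commutator (m : ℕ) (d v : ℕ → R) (q p g : R)
    (hv0 : v (2 * m + 6) = -v 0) (hv1 : v (2 * m + 5) = -v 1)
    (hd0 : d (2 * m + 7) = -d 0) (hd1 : d (2 * m + 6) = -d 1) {i j : ℕ}
    (hi : i < 2 * (m + 4)) (hj : j < 2 * (m + 4)) :
    cornerEntry (m + 4) (2 * (p - g ^ 2) * d 0) (g * v 0 * (d 0 + d 1)) i j
      = ∑ k : Fin (2 * (m + 4)), (upperEntry (m + 4) v q i k - upperEntry (m + 4) v q k i)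
            * cornerEntry (m + 4) p (g * v 0) k j
        - ∑ k : Fin (2 * (m + 4)), cornerEntry (m + 4) p (g * v 0) i k
            * (upperEntry (m + 4) v q k j - upperEntry (m + 4) v q j k)
        + ((if i = 0 ∨ i + 1 = 2 * (m + 4) then g else 0)
            - (if j = 0 ∨ j + 1 = 2 * (m + 4) then g else 0))
          * (∑ k : Fin (2 * (m + 4)), symEntry (m + 4) d v q i k * symEntry (m + 4) d v q k j
            + cornerEntry (m + 4) p (g * v 0) i j)
        + (p - g ^ 2) * (((if i = 0 then 1 else 0) - (if i + 1 = 2 * (m + 4) then 1 else 0))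
            + ((if j = 0 then 1 else 0) - (if j + 1 = 2 * (m + 4) then 1 else 0)))
          * symEntry (m + 4) d v q i j := by
  simp only [mul_comm (cornerEntry (m + 4) p (g * v 0) i _), sub_mul, Finset.sum_sub_distrib]
  rw [sum_symEntry_mul (by omega) d v q (fun k => symEntry (m + 4) d v q k j) hi,
    sum_upperEntry_row_mul (by omega) v q (fun k => cornerEntry (m + 4) p (g * v 0) k j),
    sum_upperEntry_col_mul (by omega) v q (fun k => cornerEntry (m + 4) p (g * v 0) k j) hi,
    sum_upperEntry_row_mul (by omega) v q (fun k => cornerEntry (m + 4) p (g * v 0) i k),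
    sum_upperEntry_col_mul (by omega) v q (fun k => cornerEntry (m + 4) p (g * v 0) i k) hj]
  have near (k : ℕ) (hk : k < 2 * (m + 4)) : k = 0 ∨ k = 1 ∨ k = 2 ∨ k = 2 * m + 5 ∨
      k = 2 * m + 6 ∨ k = 2 * m + 7 ∨ (3 ≤ k ∧ k < 2 * m + 5) := by omega
  simp only [symEntry, upperEntry, cornerEntry]
  rcases near i hi with rfl | rfl | rfl | rfl | rfl | rfl | h <;>
  rcases near j hj with rfl | rfl | rfl | rfl | rfl | rfl | h' <;>
  first
  | simp (disch := omega) [if_pos, if_neg, hv0, hv1]; done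
  | simp (disch := omega) [if_pos, if_neg, hv0, hv1, hd0, hd1]; ring

end PairedShift

open Matrix

/-- Superdiagonal weights (0-based) of `DnLax`. -/
def superWeight (n : ℕ) (a : ℕ → ℝ) (i : ℕ) : ℝ :=
  if i + 1 < n then a (i + 1) else if i + 1 = n then 0 else -a (2 * n - (i + 1))

/-- Diagonal entries (0-based) of `DnLax`. -/
def diagWeight (n : ℕ) (b : ℕ → ℝ) (i : ℕ) : ℝ :=
  if i < n then b (i + 1) else -b (2 * n - i)

theorem DnLax_apply {n : ℕ} (hn : 4 ≤ n) (a b : ℕ → ℝ) (i j : Fin (2 * n)) :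
    DnLax n a b i j = symEntry n (diagWeight n b) (superWeight n a) (a n) i j := by
  obtain ⟨i, hi⟩ := i
  obtain ⟨j, hj⟩ := j
  simp only [DnLax, of_apply, symEntry, upperEntry, diagWeight, superWeight]
  rcases (by omega : i = j ∨ j = i + 1 ∨ i = j + 1 ∨ j = i + 2 ∨ i = j + 2 ∨
    (i + 2 < j ∨ j + 2 < i)) with rfl | rfl | rfl | rfl | rfl | h <;>
  simp (disch := omega) only [if_pos, if_neg, add_zero, zero_add] <;>
  split_ifs <;> first | omega | simp

theorem DnLax_eq {n : ℕ} (hn : 4 ≤ n) (a b : ℕ → ℝ) :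
    DnLax n a b = diagonal (fun i : Fin (2 * n) => diagWeight n b i)
      + upperMatrix n (superWeight n a) (a n) + (upperMatrix n (superWeight n a) (a n))ᵀ := by
  ext i j
  simp [DnLax_apply hn, symEntry, upperMatrix, diagonal_apply, Fin.ext_iff]

theorem upperEntry_eq_zero_of_le {R : Type*} [CommRing R] (n : ℕ) (v : ℕ → R) (q : R) {i j : ℕ}
    (h : j ≤ i) : upperEntry n v q i j = 0 := by
  simp (disch := omega) [upperEntry, if_neg]

theorem skewPart_DnLax {n : ℕ} (hn : 4 ≤ n) (a b : ℕ → ℝ) :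
    skewPart (DnLax n a b) = upperMatrix n (superWeight n a) (a n)
      - (upperMatrix n (superWeight n a) (a n))ᵀ := by
  ext i j
  simp only [skewPart, of_apply, DnLax_apply hn, symEntry, upperMatrix, Matrix.sub_apply,
    transpose_apply]
  split_ifs with h1 h2 h3 h4
  · omega
  · simp [upperEntry_eq_zero_of_le n _ _ h1.le]
  · omega
  · simp [upperEntry_eq_zero_of_le n _ _ h3.le]
  · rw [show (i : ℕ) = j by omega]
    ring

theorem commutator_DnLax {n : ℕ} (hn : 4 ≤ n) (a b : ℕ → ℝ) (i j : Fin (2 * n)) :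
    (skewPart (DnLax n a b) * DnLax n a b - DnLax n a b * skewPart (DnLax n a b)) i j
      = (upperEntry n (superWeight n a) (a n) i j - upperEntry n (superWeight n a) (a n) j i)
          * (diagWeight n b j - diagWeight n b i)
        + (if (i : ℕ) = j then 2 * commDiag n (superWeight n a) (a n) i else 0) := by
  obtain ⟨m, rfl⟩ : ∃ m, n = m + 2 := ⟨n - 2, by omega⟩
  have key := upperMatrix_comm_transpose m (superWeight (m + 2) a) (a (m + 2))
    (by simp [superWeight]) (by
      simp (disch := omega) only [superWeight, if_pos, if_neg]
      congr 2
      omega)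
  rw [skewPart_DnLax hn, DnLax_eq hn]
  set U := upperMatrix (m + 2) (superWeight (m + 2) a) (a (m + 2)) with hU
  set D : Matrix (Fin (2 * (m + 2))) (Fin (2 * (m + 2))) ℝ :=
    diagonal fun i => diagWeight (m + 2) b i with hD
  have expand : (U - Uᵀ) * (D + U + Uᵀ) - (D + U + Uᵀ) * (U - Uᵀ)
      = U * D - D * U - (Uᵀ * D - D * Uᵀ) + ((U * Uᵀ - Uᵀ * U) + (U * Uᵀ - Uᵀ * U)) := by
    noncomm_ring
  rw [expand, key]
  simp only [hD, Matrix.add_apply, Matrix.sub_apply, mul_diagonal, diagonal_mul,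
    diagonal_apply, transpose_apply, hU, upperMatrix, of_apply, Fin.ext_iff]
  split_ifs <;> ring

theorem DnLax_sq_apply {n : ℕ} (hn : 4 ≤ n) (a b : ℕ → ℝ) (i j : Fin (2 * n)) :
    (DnLax n a b * DnLax n a b) i j
      = ∑ k : Fin (2 * n), symEntry n (diagWeight n b) (superWeight n a) (a n) i k
          * symEntry n (diagWeight n b) (superWeight n a) (a n) k j := by
  simp only [mul_apply, DnLax_apply hn]

set_option maxHeartbeats 2000000 in
theorem KTA_apply {n : ℕ} (hn : 4 ≤ n) (a b : ℕ → ℝ) (i j : Fin (2 * n)) :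
    KTA n a b i j = (((DnLax n a b * DnLax n a b) i j : ℝ) : ℂ)
      + cornerEntry n (((a (n + 1)) ^ 2 + 2 * (a (n + 1)) ^ 4 : ℝ) : ℂ)
          (((Real.sqrt 2 : ℝ) : ℂ) * Complex.I * ((a (n + 1) : ℝ) : ℂ) ^ 2 * (a 1 : ℝ)) i j := by
  obtain ⟨m, rfl⟩ : ∃ m, n = m + 4 := ⟨n - 4, by omega⟩
  obtain ⟨i, hi⟩ := i
  obtain ⟨j, hj⟩ := j
  simp only [KTA, of_apply, cornerEntry]
  by_cases h : (i = 0 ∨ i = 1 ∨ i = 2 * m + 6 ∨ i = 2 * m + 7) ∧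
    (j = 0 ∨ j = 1 ∨ j = 2 * m + 6 ∨ j = 2 * m + 7)
  · rw [DnLax_sq_apply hn]
    rw [sum_symEntry_mul (by omega) _ _ _
      (fun k => symEntry (m + 4) (diagWeight (m + 4) b) (superWeight (m + 4) a) (a (m + 4)) k j) hi]
    have e1 : 2 * (m + 4) - (2 * m + 7) = 1 := by omega
    have e2 : 2 * (m + 4) - (2 * m + 6) = 2 := by omega
    simp only [symEntry, upperEntry, diagWeight, superWeight]
    obtain ⟨rfl | rfl | rfl | rfl, rfl | rfl | rfl | rfl⟩ := h <;>
    simp (disch := omega) [if_pos, if_neg, e1, e2] <;> ring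
  · simp (disch := omega) only [if_neg, add_zero]

theorem KTC_apply {n : ℕ} (a b : ℕ → ℝ) (i j : Fin (2 * n)) :
    KTC n a b i j = ((skewPart (DnLax n a b) i j : ℝ) : ℂ)
      + diagonal (fun i : Fin (2 * n) => if (i : ℕ) = 0 ∨ (i : ℕ) + 1 = 2 * n then
          ((Real.sqrt 2 : ℝ) : ℂ) * Complex.I * ((a (n + 1) : ℝ) : ℂ) ^ 2 else 0) i j := by
  simp only [KTC, of_apply, diagonal_apply, Fin.ext_iff, skewPart]
  split_ifs <;> first | omega | simp


/-- The Kozlov–Treshchev equations in Flaschka variables at time `t`. -/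
structure KTFlowAt (n : ℕ) (a b : ℝ → ℕ → ℝ) (t : ℝ) : Prop where
  a_lt : ∀ i, 1 ≤ i → i < n → HasDerivAt (fun s => a s i) (a t i * (b t (i + 1) - b t i)) t
  a_n : HasDerivAt (fun s => a s n) (-(a t n * (b t (n - 1) + b t n))) t
  a_succ : HasDerivAt (fun s => a s (n + 1)) (a t (n + 1) * b t 1) t
  b_one : HasDerivAt (fun s => b s 1)
    (2 * (a t 1) ^ 2 - (a t (n + 1)) ^ 2 - 4 * (a t (n + 1)) ^ 4) t
  b_mid : ∀ i, 2 ≤ i → i ≤ n - 2 →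
    HasDerivAt (fun s => b s i) (2 * ((a t i) ^ 2 - (a t (i - 1)) ^ 2)) t
  b_n : HasDerivAt (fun s => b s n) (2 * ((a t n) ^ 2 - (a t (n - 1)) ^ 2)) t
  b_pred : HasDerivAt (fun s => b s (n - 1))
    (2 * ((a t n) ^ 2 + (a t (n - 1)) ^ 2 - (a t (n - 2)) ^ 2)) t

namespace KTFlowAt

variable {n : ℕ} {a b : ℝ → ℕ → ℝ} {t : ℝ}

theorem hasDerivAt_superWeight (h : KTFlowAt n a b t) {i : ℕ} (hi : i + 1 < 2 * n) :
    HasDerivAt (fun s => superWeight n (a s) i)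
      (superWeight n (a t) i * (diagWeight n (b t) (i + 1) - diagWeight n (b t) i)) t := by
  rcases lt_trichotomy (i + 1) n with hlt | heq | hgt
  · simp (disch := omega) only [superWeight, diagWeight, if_pos]
    exact h.a_lt (i + 1) (by omega) hlt
  · simp (disch := omega) only [superWeight, if_pos, if_neg, zero_mul]
    exact hasDerivAt_const t 0
  · obtain ⟨k, hk⟩ : ∃ k, 2 * n = k + (i + 1) := ⟨2 * n - (i + 1), by omega⟩
    have e1 : 2 * n - (i + 1) = k := by omega
    have e2 : 2 * n - i = k + 1 := by omega
    simp (disch := omega) only [superWeight, diagWeight, if_neg, e1, e2]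
    refine HasDerivAt.congr_deriv ((h.a_lt k (by omega) (by omega)).fun_neg) ?_
    ring

theorem hasDerivAt_upperEntry (h : KTFlowAt n a b t) (hn : 4 ≤ n) {i j : ℕ} (hj : j < 2 * n) :
    HasDerivAt (fun s => upperEntry n (superWeight n (a s)) (a s n) i j)
      (upperEntry n (superWeight n (a t)) (a t n) i j
        * (diagWeight n (b t) j - diagWeight n (b t) i)) t := by
  obtain ⟨m, rfl⟩ : ∃ m, n = m + 2 := ⟨n - 2, by omega⟩
  have hq := h.a_n
  rcases (by omega : j = i + 1 ∨ (i = m ∧ j = m + 2) ∨ (i = m + 1 ∧ j = m + 3) ∨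
    (j ≠ i + 1 ∧ ¬(i = m ∧ j = m + 2) ∧ ¬(i = m + 1 ∧ j = m + 3))) with
    rfl | ⟨rfl, rfl⟩ | ⟨rfl, rfl⟩ | h0
  · simp (disch := omega) only [upperEntry, if_neg, if_true, add_zero]
    exact h.hasDerivAt_superWeight hj
  · have e : 2 * (i + 2) - (i + 2) = i + 2 := by omega
    simp (disch := omega) only [upperEntry, diagWeight, if_pos, if_neg, and_self, if_true,
      add_zero, zero_add, e]
    refine HasDerivAt.congr_deriv (hq.fun_neg) ?_
    simp only [Nat.add_one_sub_one]
    ring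
  · have e : 2 * (m + 2) - (m + 3) = m + 1 := by omega
    simp (disch := omega) only [upperEntry, diagWeight, if_pos, if_neg, and_self, if_true,
      add_zero, zero_add, e]
    refine HasDerivAt.congr_deriv hq ?_
    simp only [Nat.add_one_sub_one]
    ring
  · simp (disch := omega) only [upperEntry, if_neg, add_zero, zero_mul]
    exact hasDerivAt_const t 0

theorem hasDerivAt_b (h : KTFlowAt n a b t) (hn : 4 ≤ n) {i : ℕ} (hi : i < n) :
    HasDerivAt (fun s => b s (i + 1)) (2 * commDiag n (superWeight n (a t)) (a t n) i
      - ((a t (n + 1)) ^ 2 + 4 * (a t (n + 1)) ^ 4) * (if i = 0 then 1 else 0)) t := by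
  obtain ⟨m, rfl⟩ : ∃ m, n = m + 2 := ⟨n - 2, by omega⟩
  rcases (by omega : i = 0 ∨ (1 ≤ i ∧ i < m) ∨ i = m ∨ i = m + 1) with rfl | h0 | rfl | rfl
  · refine HasDerivAt.congr_deriv (h.b_one) ?_
    simp (disch := omega) [commDiag, superWeight, if_pos, if_neg]
    ring
  · refine HasDerivAt.congr_deriv (h.b_mid (i + 1) (by omega) (by omega)) ?_
    simp (disch := omega) [commDiag, superWeight, if_pos, if_neg, Nat.sub_add_cancel h0.1]
  · refine HasDerivAt.congr_deriv (h.b_pred) ?_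
    simp (disch := omega) [commDiag, superWeight, if_pos, if_neg,
      Nat.sub_add_cancel (show 1 ≤ i by omega)]
    ring
  · refine HasDerivAt.congr_deriv (h.b_n) ?_
    simp (disch := omega) [commDiag, superWeight]
    ring

theorem hasDerivAt_diagWeight (h : KTFlowAt n a b t) (hn : 4 ≤ n) {i : ℕ} (hi : i < 2 * n) :
    HasDerivAt (fun s => diagWeight n (b s) i)
      (2 * commDiag n (superWeight n (a t)) (a t n) i
        - ((a t (n + 1)) ^ 2 + 4 * (a t (n + 1)) ^ 4)
          * ((if i = 0 then 1 else 0) - (if i + 1 = 2 * n then 1 else 0))) t := by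
  by_cases hin : i < n
  · simp (disch := omega) only [diagWeight, if_pos]
    refine HasDerivAt.congr_deriv (h.hasDerivAt_b hn hin) ?_
    simp (disch := omega) [if_neg]
  · obtain ⟨k, hk⟩ : ∃ k, 2 * n = i + (k + 1) := ⟨2 * n - (i + 1), by omega⟩
    have e : 2 * n - i = k + 1 := by omega
    simp (disch := omega) only [diagWeight, if_neg, e]
    refine HasDerivAt.congr_deriv ((h.hasDerivAt_b hn (i := k) (by omega)).fun_neg) ?_
    have hF : (if i + 1 = 2 * n then (1 : ℝ) else 0) = if k = 0 then 1 else 0 :=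
      if_congr (by omega) rfl rfl
    have hcomm : commDiag n (superWeight n (a t)) (a t n) i
        = -commDiag n (superWeight n (a t)) (a t n) k := by
      have e1 : 2 * n - (i + 1) = k := by omega
      have e3 (hk : 1 ≤ k) : k - 1 + 1 = k := by omega
      rcases (by omega : k + 1 = n ∨ k + 2 = n ∨ k = 0 ∨ (1 ≤ k ∧ k + 2 < n)) with
        h1 | h1 | h1 | h1 <;>
      simp (disch := omega) [commDiag, superWeight, if_pos, if_neg, e, e1, e3] <;> ring
    rw [hF, hcomm]
    ring

/-- The Lax equation for `DnLax`, perturbed by the boundary terms of the flow. -/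
theorem hasDerivAt_DnLax (h : KTFlowAt n a b t) (hn : 4 ≤ n) (i j : Fin (2 * n)) :
    HasDerivAt (fun s => DnLax n (a s) (b s) i j)
      ((skewPart (DnLax n (a t) (b t)) * DnLax n (a t) (b t)
          - DnLax n (a t) (b t) * skewPart (DnLax n (a t) (b t))
        - diagonal (fun i : Fin (2 * n) => ((a t (n + 1)) ^ 2 + 4 * (a t (n + 1)) ^ 4)
          * ((if (i : ℕ) = 0 then 1 else 0) - (if (i : ℕ) + 1 = 2 * n then 1 else 0)))
          : Matrix (Fin (2 * n)) (Fin (2 * n)) ℝ) i j) t := by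
  rw [Matrix.sub_apply (_ - _), commutator_DnLax hn]
  simp only [DnLax_apply hn, symEntry]
  have hU := h.hasDerivAt_upperEntry hn (i := i) j.2
  have hU' := h.hasDerivAt_upperEntry hn (i := j) i.2
  by_cases hij : i = j
  · subst hij
    simp only [if_true, diagonal_apply_eq]
    refine HasDerivAt.congr_deriv (((h.hasDerivAt_diagWeight hn i.2).fun_add hU).fun_add hU') ?_
    ring
  · have hij' : (i : ℕ) ≠ j := fun e => hij (Fin.ext e)
    simp only [if_neg hij', diagonal_apply_ne _ hij, zero_add]
    refine HasDerivAt.congr_deriv (hU.fun_add hU') ?_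
    ring

theorem hasDerivAt_DnLax_sq (h : KTFlowAt n a b t) (hn : 4 ≤ n) (i j : Fin (2 * n)) :
    HasDerivAt (fun s => (DnLax n (a s) (b s) * DnLax n (a s) (b s)) i j)
      ((skewPart (DnLax n (a t) (b t)) * (DnLax n (a t) (b t) * DnLax n (a t) (b t))
          - DnLax n (a t) (b t) * DnLax n (a t) (b t) * skewPart (DnLax n (a t) (b t))
            : Matrix (Fin (2 * n)) (Fin (2 * n)) ℝ) i j
        - ((a t (n + 1)) ^ 2 + 4 * (a t (n + 1)) ^ 4)
          * (((if (i : ℕ) = 0 then 1 else 0) - (if (i : ℕ) + 1 = 2 * n then 1 else 0))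
            + ((if (j : ℕ) = 0 then 1 else 0) - (if (j : ℕ) + 1 = 2 * n then 1 else 0)))
          * DnLax n (a t) (b t) i j) t := by
  have hsum := HasDerivAt.fun_sum (u := Finset.univ) fun k (_ : k ∈ Finset.univ) =>
    (h.hasDerivAt_DnLax hn i k).fun_mul (h.hasDerivAt_DnLax hn k j)
  simp only [Finset.sum_add_distrib, ← mul_apply] at hsum
  refine HasDerivAt.congr_deriv (hsum) ?_
  set L := DnLax n (a t) (b t)
  set B := skewPart L
  set D : Matrix (Fin (2 * n)) (Fin (2 * n)) ℝ :=
    diagonal fun i => ((a t (n + 1)) ^ 2 + 4 * (a t (n + 1)) ^ 4)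
      * ((if (i : ℕ) = 0 then 1 else 0) - (if (i : ℕ) + 1 = 2 * n then 1 else 0)) with hD
  have expand : (B * L - L * B - D) * L + L * (B * L - L * B - D)
      = (B * (L * L) - L * L * B) - (D * L + L * D) := by
    noncomm_ring
  rw [← Matrix.add_apply, expand, Matrix.sub_apply _ (D * L + L * D), Matrix.add_apply, hD, diagonal_mul, mul_diagonal]
  ring

end KTFlowAt

theorem HasDerivAt.cornerEntry {p x : ℝ → ℂ} {p' x' : ℂ} {t : ℝ} (hp : HasDerivAt p p' t)
    (hx : HasDerivAt x x' t) (n i j : ℕ) :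
    HasDerivAt (fun s => _root_.cornerEntry n (p s) (x s) i j)
      (_root_.cornerEntry n p' x' i j) t := by
  simp only [_root_.cornerEntry]
  split_ifs
  exacts [hp, hx, hx.fun_neg, hasDerivAt_const t 0]

theorem ofReal_upperEntry (n : ℕ) (v : ℕ → ℝ) (q : ℝ) (i j : ℕ) :
    ((upperEntry n v q i j : ℝ) : ℂ) = upperEntry n (fun k => (v k : ℂ)) (q : ℂ) i j := by
  simp only [upperEntry]
  split_ifs <;> simp

theorem ofReal_symEntry (n : ℕ) (d v : ℕ → ℝ) (q : ℝ) (i j : ℕ) :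
    ((symEntry n d v q i j : ℝ) : ℂ)
      = symEntry n (fun k => (d k : ℂ)) (fun k => (v k : ℂ)) (q : ℂ) i j := by
  simp only [symEntry, ← ofReal_upperEntry]
  split_ifs <;> simp

theorem KT_commutator_apply {n : ℕ} (hn : 4 ≤ n) (a b : ℕ → ℝ) (i j : Fin (2 * n)) :
    (KTC n a b * KTA n a b - KTA n a b * KTC n a b) i j
      = (((skewPart (DnLax n a b) * (DnLax n a b * DnLax n a b)
          - DnLax n a b * DnLax n a b * skewPart (DnLax n a b) : Matrix (Fin (2 * n)) (Fin (2 * n)) ℝ) i j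
        - ((a (n + 1)) ^ 2 + 4 * (a (n + 1)) ^ 4)
          * (((if (i : ℕ) = 0 then 1 else 0) - (if (i : ℕ) + 1 = 2 * n then 1 else 0))
            + ((if (j : ℕ) = 0 then 1 else 0) - (if (j : ℕ) + 1 = 2 * n then 1 else 0)))
          * DnLax n a b i j : ℝ) : ℂ)
        + cornerEntry n
          (2 * (((a (n + 1) : ℝ) : ℂ) ^ 2 + 4 * ((a (n + 1) : ℝ) : ℂ) ^ 4) * ((b 1 : ℝ) : ℂ))
          (((Real.sqrt 2 : ℝ) : ℂ) * Complex.I * ((a (n + 1) : ℝ) : ℂ) ^ 2 * ((a 1 : ℝ) : ℂ)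
            * (((b 1 : ℝ) : ℂ) + ((b 2 : ℝ) : ℂ)))
          i j := by
  obtain ⟨m, rfl⟩ : ∃ m, n = m + 4 := ⟨n - 4, by omega⟩
  set g : ℂ := ((Real.sqrt 2 : ℝ) : ℂ) * Complex.I * ((a (m + 4 + 1) : ℝ) : ℂ) ^ 2 with hg
  set p : ℂ := (((a (m + 4 + 1)) ^ 2 + 2 * (a (m + 4 + 1)) ^ 4 : ℝ) : ℂ) with hp
  have hpg : p - g ^ 2 = (a (m + 4 + 1) : ℂ) ^ 2 + 4 * (a (m + 4 + 1) : ℂ) ^ 4 := by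
    have h2 : ((Real.sqrt 2 : ℝ) : ℂ) ^ 2 = 2 := by
      rw [← Complex.ofReal_pow, Real.sq_sqrt (by norm_num)]
      norm_num
    rw [hg, hp, mul_pow, mul_pow, h2, Complex.I_sq]
    push_cast
    ring
  have key := cornerEntry_commutator m (fun k => (diagWeight (m + 4) b k : ℂ))
    (fun k => (superWeight (m + 4) a k : ℂ)) (a (m + 4) : ℂ) p g
    (by simp (disch := omega) [superWeight, if_neg,
      show 2 * (m + 4) - (2 * m + 6 + 1) = 1 by omega])
    (by simp (disch := omega) [superWeight, if_neg,
      show 2 * (m + 4) - (2 * m + 5 + 1) = 2 by omega])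
    (by simp (disch := omega) [diagWeight, if_neg,
      show 2 * (m + 4) - (2 * m + 7) = 1 by omega])
    (by simp (disch := omega) [diagWeight, if_neg,
      show 2 * (m + 4) - (2 * m + 6) = 2 by omega])
    i.2 j.2
  have hv0 : superWeight (m + 4) a 0 = a 1 := by simp [superWeight]
  have hd0 : diagWeight (m + 4) b 0 = b 1 := by simp [diagWeight]
  have hd1 : diagWeight (m + 4) b 1 = b 2 := by simp [diagWeight]
  simp only [hv0, hd0, hd1, ← ofReal_upperEntry, ← ofReal_symEntry] at key
  have hB (k l : Fin (2 * (m + 4))) : skewPart (DnLax (m + 4) a b) k l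
      = upperEntry (m + 4) (superWeight (m + 4) a) (a (m + 4)) k l
        - upperEntry (m + 4) (superWeight (m + 4) a) (a (m + 4)) l k := by
    rw [skewPart_DnLax hn]
    rfl
  simp only [← Complex.ofReal_sub, ← hB, ← DnLax_apply hn, ← Complex.ofReal_mul,
    ← Complex.ofReal_sum, ← mul_apply] at key
  set L := DnLax (m + 4) a b with hL
  set B := skewPart L
  set P : Matrix (Fin (2 * (m + 4))) (Fin (2 * (m + 4))) ℂ :=
    of fun i j => cornerEntry (m + 4) p (g * a 1) i j with hP
  set D : Matrix (Fin (2 * (m + 4))) (Fin (2 * (m + 4))) ℂ :=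
    diagonal fun i => if (i : ℕ) = 0 ∨ (i : ℕ) + 1 = 2 * (m + 4) then g else 0 with hD
  have hA : KTA (m + 4) a b = (L * L).map Complex.ofRealHom + P := by
    ext k l
    exact KTA_apply hn a b k l
  have hC : KTC (m + 4) a b = B.map Complex.ofRealHom + D := by
    ext k l
    exact KTC_apply a b k l
  have expand (X Y : Matrix (Fin (2 * (m + 4))) (Fin (2 * (m + 4))) ℂ) :
      (X + D) * (Y + P) - (Y + P) * (X + D)
        = (X * Y - Y * X) + ((X * P - P * X) + (D * (Y + P) - (Y + P) * D)) := by
    noncomm_ring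
  have hBP : (B.map Complex.ofRealHom * P) i j
      = ∑ k : Fin (2 * (m + 4)), (B i k : ℂ) * cornerEntry (m + 4) p (g * a 1) k j := rfl
  have hPB : (P * B.map Complex.ofRealHom) i j
      = ∑ k : Fin (2 * (m + 4)), cornerEntry (m + 4) p (g * a 1) i k * (B k j : ℂ) := rfl
  rw [hA, hC, expand, ← Matrix.map_mul, ← Matrix.map_mul, Matrix.add_apply, Matrix.add_apply, ← hpg,
    key]
  rw [Matrix.sub_apply (_ * P), hBP, hPB]
  simp only [Matrix.sub_apply, hD, diagonal_mul, mul_diagonal, Matrix.add_apply, map_apply,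
    Complex.ofRealHom_eq_coe, hP, of_apply, Complex.ofReal_sub, Complex.ofReal_mul,
    Complex.ofReal_add, apply_ite Complex.ofReal, Complex.ofReal_one, Complex.ofReal_zero,
    Complex.ofReal_pow, Complex.ofReal_ofNat]
  rw [← hpg]
  ring

/-- Along any differentiable solution of the Kozlov–Treshchev system in
Flaschka variables (`n ≥ 4`), the matrices `A` and `C` satisfy the Lax equation
`A'(t) = C(t)A(t) − A(t)C(t)`. -/
theorem KT_lax (n : ℕ) (hn : 4 ≤ n)
    (a b : ℝ → ℕ → ℝ)
    (ha : ∀ (t : ℝ), ∀ i ∈ Finset.Icc 1 (n - 1),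
      HasDerivAt (fun s => a s i) (a t i * (b t (i + 1) - b t i)) t)
    (han : ∀ t : ℝ, HasDerivAt (fun s => a s n) (-(a t n * (b t (n - 1) + b t n))) t)
    (han1 : ∀ t : ℝ, HasDerivAt (fun s => a s (n + 1)) (a t (n + 1) * b t 1) t)
    (hb1 : ∀ t : ℝ, HasDerivAt (fun s => b s 1)
      (2 * (a t 1) ^ 2 - (a t (n + 1)) ^ 2 - 4 * (a t (n + 1)) ^ 4) t)
    (hb : ∀ (t : ℝ), ∀ i ∈ Finset.Icc 2 (n - 2),
      HasDerivAt (fun s => b s i) (2 * ((a t i) ^ 2 - (a t (i - 1)) ^ 2)) t)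
    (hbn : ∀ t : ℝ, HasDerivAt (fun s => b s n) (2 * ((a t n) ^ 2 - (a t (n - 1)) ^ 2)) t)
    (hbn1 : ∀ t : ℝ, HasDerivAt (fun s => b s (n - 1))
      (2 * ((a t n) ^ 2 + (a t (n - 1)) ^ 2 - (a t (n - 2)) ^ 2)) t) :
    ∀ (t : ℝ) (i j : Fin (2 * n)),
      HasDerivAt (fun s => KTA n (a s) (b s) i j)
        ((KTC n (a t) (b t) * KTA n (a t) (b t)
          - KTA n (a t) (b t) * KTC n (a t) (b t)) i j) t := by
  intro t i j
  have h : KTFlowAt n a b t :=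
    { a_lt := fun i h1 h2 => ha t i (Finset.mem_Icc.2 ⟨h1, by omega⟩)
      a_n := han t
      a_succ := han1 t
      b_one := hb1 t
      b_mid := fun i h1 h2 => hb t i (Finset.mem_Icc.2 ⟨h1, h2⟩)
      b_n := hbn t
      b_pred := hbn1 t }
  simp only [KTA_apply hn]
  rw [KT_commutator_apply hn]
  have h1 := ha t 1 (Finset.mem_Icc.2 ⟨le_rfl, by omega⟩)
  have hc := (han1 t).ofReal_comp
  refine (h.hasDerivAt_DnLax_sq hn i j).ofReal_comp.fun_add (HasDerivAt.cornerEntry ?_ ?_ n i j)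
  · refine HasDerivAt.congr_deriv (((((han1 t).fun_pow 2).fun_add (((han1 t).fun_pow 4).const_mul 2))).ofReal_comp) ?_
    push_cast
    ring
  · refine HasDerivAt.congr_deriv (((hc.fun_pow 2).const_mul (((Real.sqrt 2 : ℝ) : ℂ) * Complex.I)).fun_mul
      h1.ofReal_comp) ?_
    push_cast
    ring
end

section
/- Let n ≥ 4 and let (a_1(t), …, a_{n+1}(t), b_1(t), …, b_n(t)) be a differentiable solution of the Kozlov–Treshchev system in Flaschka variables, and let A(t) be the 2n×2n complex matrix defined as A = L² except A_{11} = A_{2n,2n} = a_1² + b_1² + a_{n+1}² + 2a_{n+1}⁴, A_{12} = A_{2n,2n−1} = a_1(b_1 + b_2 + √2 i a_{n+1}²), A_{21} = A_{2n−1,2n} = a_1(b_1 + b_2 − √2 i a_{n+1}²), where L is the 2n×2n symmetric matrix with diagonal (b_1, …, b_n, −b_n, …, −b_1), superdiagonal entries L_{i,i+1} = a_i for i = 1, …, n−1, L_{n,n+1} = 0, L_{n+j,n+j+1} = −a_{n−j} for j = 1, …, n−1, additional entries L_{n−1,n+1} = L_{n+1,n−1} = −a_n, L_{n,n+2} = L_{n+2,n}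 = a_n, and all other entries zero. Then for each k = 1, …, n the function h_{2k}(t) = ½Tr(A(t)^k) is constant in t; in particular h_2 = ½Tr(A) = Σ_{i=1}^n b_i² + 2Σ_{i=1}^n a_i² + a_{n+1}² + 2a_{n+1}⁴ is a constant of motion. -/
/-- The `n × n` tridiagonal matrix with (1-based) diagonal entries `d i`, superdiagonal entries
`u i` at `(i, i + 1)` and subdiagonal entries `l i` at `(i + 1, i)`. -/
def tridiag {R : Type*} [Zero R] (n : ℕ) (d u l : ℕ → R) : Matrix (Fin n) (Fin n) R :=
  Matrix.of fun i j =>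
    if (j : ℕ) = i then d (i + 1)
    else if (j : ℕ) = i + 1 then u (i + 1)
    else if (i : ℕ) = j + 1 then l (j + 1)
    else 0

/-- The `n × n` pentadiagonal matrix with (1-based) entries `d i` at `(i, i)`, `u i` at
`(i, i + 1)`, `l i` at `(i + 1, i)`, `v i` at `(i, i + 2)` and `m i` at `(i + 2, i)`. -/
def pentadiag {R : Type*} [Zero R] (n : ℕ) (d u l v m : ℕ → R) : Matrix (Fin n) (Fin n) R :=
  Matrix.of fun i j =>
    if (j : ℕ) = i then d (i + 1)
    else if (j : ℕ) = i + 1 then u (i + 1)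
    else if (i : ℕ) = j + 1 then l (j + 1)
    else if (j : ℕ) = i + 2 then v (i + 1)
    else if (i : ℕ) = j + 2 then m (j + 1)
    else 0

section Tridiagonal

variable {R : Type*} [CommRing R] {n : ℕ}

lemma sum_tridiag_mul {d u l : ℕ → R} (hu : u n = 0) (hl : l 0 = 0) (y : ℕ → R) (i : Fin n) :
    ∑ k : Fin n, tridiag n d u l i k * y k
      = d (i + 1) * y i + u (i + 1) * y (i + 1) + l i * y (i - 1) := by
  obtain ⟨i, hi⟩ := i
  have h : ∀ k : Fin n, tridiag n d u l ⟨i, hi⟩ k * y k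
      = (if (k : ℕ) = i then d (i + 1) * y i else 0)
        + (if (k : ℕ) = i + 1 then u (i + 1) * y (i + 1) else 0)
        + (if (k : ℕ) = i - 1 then l i * y (i - 1) else 0) := by
    rintro ⟨k, hk⟩
    simp only [tridiag, Matrix.of_apply]
    rcases i with _ | i
    · simp only [hl]
      split_ifs <;> first | contradiction | omega | (subst_vars; simp)
    · split_ifs <;> first | contradiction | omega | (subst_vars; simp)
  rw [Finset.sum_congr rfl fun k _ => h k, Fin.sum_univ_eq_sum_range (fun k : ℕ =>
    (if k = i then d (i + 1) * y i else 0) + (if k = i + 1 then u (i + 1) * y (i + 1) else 0)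
      + (if k = i - 1 then l i * y (i - 1) else 0)), Finset.sum_add_distrib, Finset.sum_add_distrib, Finset.sum_ite_eq', Finset.sum_ite_eq', Finset.sum_ite_eq',
    if_pos (by simpa using hi : i ∈ Finset.range n),
    if_pos (Finset.mem_range.2 (by omega) : i - 1 ∈ Finset.range n)]
  congr 2
  by_cases h' : i + 1 = n
  · simp [h', hu]
  · rw [if_pos (Finset.mem_range.2 (by omega))]

lemma tridiag_mul_tridiag {d u l d' u' l' : ℕ → R} (hu : u n = 0) (hl : l 0 = 0) :
    tridiag n d u l * tridiag n d' u' l'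
      = pentadiag n (fun i => d i * d' i + u i * l' i + l (i - 1) * u' (i - 1))
          (fun i => d i * u' i + u i * d' (i + 1)) (fun i => l i * d' i + d (i + 1) * l' i)
          (fun i => u i * u' (i + 1)) (fun i => l (i + 1) * l' i) := by
  ext i j
  have h := sum_tridiag_mul (d := d) hu hl (fun k => if (j : ℕ) = k then d' (k + 1)
    else if (j : ℕ) = k + 1 then u' (k + 1) else if k = j + 1 then l' (j + 1) else 0) i
  rw [Matrix.mul_apply]
  refine Eq.trans h ?_
  obtain ⟨i, hi⟩ := i
  obtain ⟨j, hj⟩ := j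
  simp only [pentadiag, Matrix.of_apply]
  rcases i with _ | i
  · simp only [hl]
    split_ifs <;> first | contradiction | omega | (subst_vars; simp)
  · split_ifs <;> first | contradiction | omega | (subst_vars; simp <;> ring)

lemma tridiag_eq_diagonal (x : ℕ → R) :
    tridiag n x 0 0 = Matrix.diagonal fun i : Fin n => x (i + 1) := by
  ext i j
  simp only [tridiag, Matrix.of_apply, Matrix.diagonal_apply, Fin.ext_iff, Pi.zero_apply]
  split_ifs <;> first | contradiction | omega | rfl

lemma diagonal_mul_tridiag (x d u l : ℕ → R) :
    tridiag n x 0 0 * tridiag n d u l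
      = tridiag n (fun i => x i * d i) (fun i => x i * u i) (fun i => x (i + 1) * l i) := by
  ext i j
  rw [tridiag_eq_diagonal, Matrix.diagonal_mul]
  simp only [tridiag, Matrix.of_apply]
  split_ifs <;> simp_all

lemma tridiag_mul_diagonal (x d u l : ℕ → R) :
    tridiag n d u l * tridiag n x 0 0
      = tridiag n (fun i => x i * d i) (fun i => x (i + 1) * u i) (fun i => x i * l i) := by
  ext i j
  rw [tridiag_eq_diagonal, Matrix.mul_diagonal]
  simp only [tridiag, Matrix.of_apply]
  split_ifs <;> simp_all [mul_comm]

lemma tridiag_add (d u l d' u' l' : ℕ → R) :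
    tridiag n d u l + tridiag n d' u' l' = tridiag n (d + d') (u + u') (l + l') := by
  ext i j
  simp only [tridiag, Matrix.of_apply, Matrix.add_apply, Pi.add_apply]
  split_ifs <;> simp

lemma tridiag_sub (d u l d' u' l' : ℕ → R) :
    tridiag n d u l - tridiag n d' u' l' = tridiag n (d - d') (u - u') (l - l') := by
  ext i j
  simp only [tridiag, Matrix.of_apply, Matrix.sub_apply, Pi.sub_apply]
  split_ifs <;> simp

lemma tridiag_eq_pentadiag (d u l : ℕ → R) : tridiag n d u l = pentadiag n d u l 0 0 := by
  ext i j
  simp only [tridiag, pentadiag, Matrix.of_apply, Pi.zero_apply, ite_self]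

lemma pentadiag_add (d u l v m d' u' l' v' m' : ℕ → R) :
    pentadiag n d u l v m + pentadiag n d' u' l' v' m'
      = pentadiag n (d + d') (u + u') (l + l') (v + v') (m + m') := by
  ext i j
  simp only [pentadiag, Matrix.of_apply, Matrix.add_apply, Pi.add_apply]
  split_ifs <;> simp

lemma pentadiag_sub (d u l v m d' u' l' v' m' : ℕ → R) :
    pentadiag n d u l v m - pentadiag n d' u' l' v' m'
      = pentadiag n (d - d') (u - u') (l - l') (v - v') (m - m') := by
  ext i j
  simp only [pentadiag, Matrix.of_apply, Matrix.sub_apply, Pi.sub_apply]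
  split_ifs <;> simp

lemma pentadiag_congr {d u l v m d' u' l' v' m' : ℕ → R}
    (hd : ∀ i < n, d (i + 1) = d' (i + 1)) (hu : ∀ i, i + 1 < n → u (i + 1) = u' (i + 1))
    (hl : ∀ i, i + 1 < n → l (i + 1) = l' (i + 1)) (hv : ∀ i, i + 2 < n → v (i + 1) = v' (i + 1))
    (hm : ∀ i, i + 2 < n → m (i + 1) = m' (i + 1)) :
    pentadiag n d u l v m = pentadiag n d' u' l' v' m' := by
  ext ⟨i, hi⟩ ⟨j, hj⟩
  simp only [pentadiag, Matrix.of_apply]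
  split_ifs
  · exact hd i hi
  · exact hu i (by omega)
  · exact hl j (by omega)
  · exact hv i (by omega)
  · exact hm j (by omega)
  · rfl

/-- The Toda-type Lax equation `U' = M U - U N + P` for a tridiagonal matrix `U`, with `M`, `N`
skew-symmetric and a perturbation `P` of the first diagonal entry. -/
lemma tridiag_lax {b u l : ℕ → R} (p : R) (hl0 : l 0 = 0) (hun : u n = 0)
    (hln : l n = 0) (hlu : ∀ i, (l i - u i) * u (i + 1) = 0)
    (hll : ∀ i, (l i - u i) * l (i + 1) = 0) :
    tridiag n (fun i => l i ^ 2 + u i ^ 2 - 2 * (l (i - 1) * u (i - 1)) + (Pi.single 1 p : ℕ → R) i)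
        (fun i => l i * b (i + 1) - b i * u i) (fun i => u i * b (i + 1) - b i * l i)
      = tridiag n 0 l (-l) * tridiag n b u l - tridiag n b u l * tridiag n 0 u (-u)
        + tridiag n (Pi.single 1 p) 0 0 := by
  rw [tridiag_mul_tridiag hln (by simp [hl0]), tridiag_mul_tridiag hun hl0,
    tridiag_eq_pentadiag, tridiag_eq_pentadiag, pentadiag_sub, pentadiag_add]
  refine pentadiag_congr ?_ ?_ ?_ ?_ ?_ <;> intro i _ <;>
    simp only [Pi.add_apply, Pi.sub_apply, Pi.neg_apply, Pi.zero_apply, add_tsub_cancel_right]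
  · ring
  · ring
  · ring
  · linear_combination -hlu (i + 1)
  · linear_combination hll (i + 1)

/-- The compatibility condition on the corner corrections in the Kozlov–Treshchev Lax equation. -/
lemma tridiag_corner {b u l : ℕ → R} {c r : R} (hr : r ^ 2 = -2) (hn : 4 ≤ n)
    (hu0 : u 0 = 0) (hun : u n = 0) (hln : l n = 0) (hlu1 : l 1 = u 1) :
    tridiag n (Pi.single 1 (-c ^ 2 - 4 * c ^ 4)) 0 0 * tridiag n b u l
        + tridiag n b l u * tridiag n (Pi.single 1 (-c ^ 2 - 4 * c ^ 4)) 0 0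
        + tridiag n (Pi.single 1 (2 * c ^ 2 * b 1 + 8 * c ^ 4 * b 1))
            (Pi.single 1 (u 1 * r * c ^ 2 * (b 1 + b 2)))
            (Pi.single 1 (-(u 1 * r * c ^ 2 * (b 1 + b 2))))
      = tridiag n 0 u (-u) * tridiag n (Pi.single 1 (c ^ 2 + 2 * c ^ 4))
            (Pi.single 1 (u 1 * r * c ^ 2)) (Pi.single 1 (-(u 1 * r * c ^ 2)))
        - tridiag n (Pi.single 1 (c ^ 2 + 2 * c ^ 4))
            (Pi.single 1 (u 1 * r * c ^ 2)) (Pi.single 1 (-(u 1 * r * c ^ 2)))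
            * tridiag n 0 u (-u)
        + (tridiag n (Pi.single 1 (r * c ^ 2)) 0 0 * tridiag n b l u * tridiag n b u l
          - tridiag n b l u * (tridiag n b u l * tridiag n (Pi.single 1 (r * c ^ 2)) 0 0))
        + (tridiag n (Pi.single 1 (r * c ^ 2)) 0 0 * tridiag n (Pi.single 1 (c ^ 2 + 2 * c ^ 4))
            (Pi.single 1 (u 1 * r * c ^ 2)) (Pi.single 1 (-(u 1 * r * c ^ 2)))
          - tridiag n (Pi.single 1 (c ^ 2 + 2 * c ^ 4))
            (Pi.single 1 (u 1 * r * c ^ 2)) (Pi.single 1 (-(u 1 * r * c ^ 2)))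
            * tridiag n (Pi.single 1 (r * c ^ 2)) 0 0) := by
  have hn1 : n ≠ 1 := by omega
  simp only [diagonal_mul_tridiag, tridiag_mul_diagonal, tridiag_add, tridiag_sub]
  rw [tridiag_mul_tridiag hun (by simp [hu0]), tridiag_mul_tridiag (by simp [hn1]) (by simp),
    tridiag_mul_tridiag (by simp [hln]) (by simp [hu0]), tridiag_mul_tridiag hln hu0]
  simp only [tridiag_eq_pentadiag, pentadiag_add, pentadiag_sub]
  refine pentadiag_congr ?_ ?_ ?_ ?_ ?_ <;> intro i _ <;> rcases i with _ | _ | i <;>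
    simp [Pi.single_apply, hu0, hlu1]
  all_goals first | ring1 | linear_combination (-u 1 * c ^ 4) * hr

end Tridiagonal

section LaxPair

variable {ι : Type*} [Fintype ι]

lemma hasDerivAt_matrix_mul {X Y : ℝ → Matrix ι ι ℂ} {X' Y' : Matrix ι ι ℂ} {t : ℝ}
    (hX : ∀ i j, HasDerivAt (fun s => X s i j) (X' i j) t)
    (hY : ∀ i j, HasDerivAt (fun s => Y s i j) (Y' i j) t) (i j : ι) :
    HasDerivAt (fun s => (X s * Y s) i j) ((X' * Y t + X t * Y') i j) t := by
  simp only [Matrix.mul_apply, Matrix.add_apply, ← Finset.sum_add_distrib]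
  exact HasDerivAt.fun_sum fun k _ => (hX i k).mul (hY k j)

variable [DecidableEq ι]

lemma hasDerivAt_matrix_pow_of_lax {X : ℝ → Matrix ι ι ℂ} {Q : Matrix ι ι ℂ} {t : ℝ}
    (hX : ∀ i j, HasDerivAt (fun s => X s i j) ((Q * X t - X t * Q) i j) t) (k : ℕ) (i j : ι) :
    HasDerivAt (fun s => (X s ^ k) i j) ((Q * X t ^ k - X t ^ k * Q) i j) t := by
  induction k generalizing i j with
  | zero => simpa using hasDerivAt_const t ((1 : Matrix ι ι ℂ) i j)
  | succ k ih =>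
    simp only [pow_succ]
    refine (hasDerivAt_matrix_mul ih hX i j).congr_deriv ?_
    refine congrFun (congrFun ?_ i) j
    noncomm_ring

/-- The traces of powers are constant along a Lax equation `X' = [Q, X]`. -/
lemma trace_pow_eq_of_lax {X Q : ℝ → Matrix ι ι ℂ}
    (hX : ∀ t i j, HasDerivAt (fun s => X s i j) ((Q t * X t - X t * Q t) i j) t)
    (k : ℕ) (s t : ℝ) : (X s ^ k).trace = (X t ^ k).trace := by
  have h : ∀ t, HasDerivAt (fun s => (X s ^ k).trace) 0 t := by
    intro t
    have h0 : (0 : ℂ) = (Q t * X t ^ k - X t ^ k * Q t).trace := by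
      rw [Matrix.trace_sub, Matrix.trace_mul_comm, sub_self]
    rw [h0]
    exact HasDerivAt.fun_sum fun i _ => hasDerivAt_matrix_pow_of_lax (hX t) k i i
  exact is_const_of_deriv_eq_zero (fun t => (h t).differentiableAt) (fun t => (h t).deriv) s t

/-- Trace of powers of a symmetric block matrix. -/
lemma trace_fromBlocks_pow (X Y : Matrix ι ι ℂ) (k : ℕ) :
    (Matrix.fromBlocks X Y Y X ^ k).trace = ((X + Y) ^ k).trace + ((X - Y) ^ k).trace := by
  obtain ⟨Z, W, h, h1, h2⟩ : ∃ Z W : Matrix ι ι ℂ, Matrix.fromBlocks X Y Y X ^ k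
      = Matrix.fromBlocks Z W W Z ∧ Z + W = (X + Y) ^ k ∧ Z - W = (X - Y) ^ k := by
    induction k with
    | zero => exact ⟨1, 0, by simp [Matrix.fromBlocks_one], by simp, by simp⟩
    | succ k ih =>
      obtain ⟨Z, W, h, h1, h2⟩ := ih
      refine ⟨Z * X + W * Y, Z * Y + W * X, ?_, ?_, ?_⟩
      · rw [pow_succ, h, Matrix.fromBlocks_multiply, add_comm (W * X), add_comm (W * Y)]
      · rw [pow_succ, ← h1]; noncomm_ring
      · rw [pow_succ, ← h2]; noncomm_ring
  rw [h, ← h1, ← h2, Matrix.trace_add, Matrix.trace_sub]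
  simp only [Matrix.trace, Fintype.sum_sum_type, Matrix.diag_apply, Matrix.fromBlocks_apply₁₁,
    Matrix.fromBlocks_apply₂₂]
  ring

end LaxPair

lemma hasDerivAt_tridiag {n : ℕ} {d u l : ℝ → ℕ → ℂ} {d' u' l' : ℕ → ℂ} {t : ℝ}
    (hd : ∀ i < n, HasDerivAt (fun s => d s (i + 1)) (d' (i + 1)) t)
    (hu : ∀ i, i + 1 < n → HasDerivAt (fun s => u s (i + 1)) (u' (i + 1)) t)
    (hl : ∀ i, i + 1 < n → HasDerivAt (fun s => l s (i + 1)) (l' (i + 1)) t) (i j : Fin n) :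
    HasDerivAt (fun s => tridiag n (d s) (u s) (l s) i j) (tridiag n d' u' l' i j) t := by
  obtain ⟨i, hi⟩ := i
  obtain ⟨j, hj⟩ := j
  simp only [tridiag, Matrix.of_apply]
  split_ifs
  · exact hd i hi
  · exact hu i (by omega)
  · exact hl j (by omega)
  · exact hasDerivAt_const t 0

/-- The corner correction turning `Uᵀ U` into the Kozlov–Treshchev Lax matrix. -/
def cornerCorrection (n : ℕ) (x r c : ℂ) : Matrix (Fin n) (Fin n) ℂ :=
  tridiag n (Pi.single 1 (c ^ 2 + 2 * c ^ 4)) (Pi.single 1 (x * r * c ^ 2))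
    (Pi.single 1 (-(x * r * c ^ 2)))

/-- Conservation of the trace invariants for the `n × n` form of the Kozlov–Treshchev system. -/
lemma trace_pow_tridiag_const {n : ℕ} (hn : 4 ≤ n) {r : ℂ} (hr : r ^ 2 = -2)
    {b u l : ℝ → ℕ → ℂ} {c : ℝ → ℂ}
    (hu0 : ∀ t, u t 0 = 0) (hl0 : ∀ t, l t 0 = 0) (hun : ∀ t, u t n = 0) (hln : ∀ t, l t n = 0)
    (hul : ∀ t i, i ≠ n - 1 → l t i = u t i)
    (hb : ∀ t, ∀ i < n, HasDerivAt (fun s => b s (i + 1))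
      (l t (i + 1) ^ 2 + u t (i + 1) ^ 2 - 2 * (l t i * u t i)
        + (Pi.single 1 (-c t ^ 2 - 4 * c t ^ 4) : ℕ → ℂ) (i + 1)) t)
    (hu : ∀ t i, i + 1 < n → HasDerivAt (fun s => u s (i + 1))
      (l t (i + 1) * b t (i + 2) - b t (i + 1) * u t (i + 1)) t)
    (hl : ∀ t i, i + 1 < n → HasDerivAt (fun s => l s (i + 1))
      (u t (i + 1) * b t (i + 2) - b t (i + 1) * l t (i + 1)) t)
    (hc : ∀ t, HasDerivAt c (c t * b t 1) t) (k : ℕ) (s t : ℝ) :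
    ((tridiag n (b s) (l s) (u s) * tridiag n (b s) (u s) (l s)
        + cornerCorrection n (u s 1) r (c s)) ^ k).trace
      = ((tridiag n (b t) (l t) (u t) * tridiag n (b t) (u t) (l t)
        + cornerCorrection n (u t 1) r (c t)) ^ k).trace := by
  refine trace_pow_eq_of_lax (X := fun t => tridiag n (b t) (l t) (u t)
    * tridiag n (b t) (u t) (l t) + cornerCorrection n (u t 1) r (c t))
    (Q := fun t => tridiag n 0 (u t) (-u t) + tridiag n (Pi.single 1 (r * c t ^ 2)) 0 0) ?_ k s t
  intro t i j
  have h1 : ∀ i, (l t i - u t i) * u t (i + 1) = 0 := by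
    intro i
    by_cases h : i = n - 1
    · rw [h, Nat.sub_add_cancel (by omega), hun, mul_zero]
    · rw [hul t i h, sub_self, zero_mul]
  have h2 : ∀ i, (l t i - u t i) * l t (i + 1) = 0 := by
    intro i
    by_cases h : i = n - 1
    · rw [h, Nat.sub_add_cancel (by omega), hln, mul_zero]
    · rw [hul t i h, sub_self, zero_mul]
  have hU := hasDerivAt_tridiag (u' := fun i => l t i * b t (i + 1) - b t i * u t i)
    (l' := fun i => u t i * b t (i + 1) - b t i * l t i)
    (d' := fun i => l t i ^ 2 + u t i ^ 2 - 2 * (l t (i - 1) * u t (i - 1))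
      + (Pi.single 1 (-c t ^ 2 - 4 * c t ^ 4) : ℕ → ℂ) i) (hb t) (hu t) (hl t)
  have hV := hasDerivAt_tridiag (u' := fun i => u t i * b t (i + 1) - b t i * l t i)
    (l' := fun i => l t i * b t (i + 1) - b t i * u t i)
    (d' := fun i => u t i ^ 2 + l t i ^ 2 - 2 * (u t (i - 1) * l t (i - 1))
      + (Pi.single 1 (-c t ^ 2 - 4 * c t ^ 4) : ℕ → ℂ) i)
    (fun i hi => by
      simpa only [add_comm (u t _ ^ 2), mul_comm (u t _), add_tsub_cancel_right] using hb t i hi)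
    (hl t) (hu t)
  rw [tridiag_lax _ (hl0 t) (hun t) (hln t) h1 h2] at hU
  rw [tridiag_lax _ (hu0 t) (hln t) (hun t)
    (fun i => by linear_combination -h2 i) (fun i => by linear_combination -h1 i)] at hV
  have hu1 : HasDerivAt (fun s => u s 1) (u t 1 * (b t 2 - b t 1)) t := by
    have := hu t 0 (by omega)
    rw [hul t _ (by omega)] at this
    exact this.congr_deriv (by ring)
  have hg : HasDerivAt (fun s => c s ^ 2 + 2 * c s ^ 4)
      (2 * c t ^ 2 * b t 1 + 8 * c t ^ 4 * b t 1) t := by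
    refine (((hc t).fun_pow 2).fun_add (((hc t).fun_pow 4).const_mul 2)).congr_deriv ?_
    push_cast
    ring
  have hf : HasDerivAt (fun s => u s 1 * r * c s ^ 2)
      (u t 1 * r * c t ^ 2 * (b t 1 + b t 2)) t := by
    refine ((hu1.mul_const r).fun_mul ((hc t).fun_pow 2)).congr_deriv ?_
    push_cast
    ring
  have hsingle : ∀ {f : ℝ → ℂ} {f' : ℂ}, HasDerivAt f f' t → ∀ i : ℕ,
      HasDerivAt (fun s => (Pi.single 1 (f s) : ℕ → ℂ) i) ((Pi.single 1 f' : ℕ → ℂ) i) t := by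
    intro f f' h i
    by_cases hi : i = 1
    · subst hi; simpa using h
    · simpa [hi] using hasDerivAt_const t (0 : ℂ)
  have hE := hasDerivAt_tridiag (n := n) (fun i _ => hsingle hg (i + 1))
    (fun i _ => hsingle hf (i + 1)) (fun i _ => hsingle hf.fun_neg (i + 1))
  have hcorner := tridiag_corner (b := b t) (c := c t) hr hn (hu0 t) (hun t) (hln t)
    (hul t 1 (by omega))
  refine ((hasDerivAt_matrix_mul hV hU i j).fun_add (hE i j)).congr_deriv ?_
  rw [← Matrix.add_apply]
  refine congrArg (fun Z : Matrix (Fin n) (Fin n) ℂ => Z i j) ?_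
  rw [cornerCorrection]
  linear_combination (norm := noncomm_ring) hcorner

/-- The index equivalence listing the second half of `Fin (2 * n)` in reverse order. -/
def foldEquiv (n : ℕ) : Fin n ⊕ Fin n ≃ Fin (2 * n) :=
  ((Equiv.sumCongr (Equiv.refl _) Fin.revPerm).trans finSumFinEquiv).trans
    (finCongr (two_mul n).symm)

lemma foldEquiv_inl {n : ℕ} (i : Fin n) : (foldEquiv n (Sum.inl i) : ℕ) = i := by
  simp [foldEquiv]

lemma foldEquiv_inr {n : ℕ} (i : Fin n) :
    (foldEquiv n (Sum.inr i) : ℕ) = n + (n - (i + 1)) := by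
  simp [foldEquiv, add_comm]

/-- Off-diagonal coefficients `a_1, …, a_{n-2}, a_{n-1} + ε a_n`, extended by zero. -/
noncomputable def offDiag (n : ℕ) (ε : ℝ) (a : ℕ → ℝ) (i : ℕ) : ℂ :=
  if i = 0 ∨ n ≤ i then 0 else if i = n - 1 then ((a i + ε * a n : ℝ) : ℂ) else (a i : ℂ)

/-- The sequence equal to `-a_n` at `n - 1` and zero elsewhere. -/
noncomputable def branchCoeff (n : ℕ) (a : ℕ → ℝ) (i : ℕ) : ℂ :=
  if i = n - 1 then -(a n : ℂ) else 0

lemma DnLax_submatrix_foldEquiv {n : ℕ} (hn : 4 ≤ n) (a b : ℕ → ℝ) :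
    ((DnLax n a b).map (fun x : ℝ => (x : ℂ))).submatrix (foldEquiv n) (foldEquiv n)
      = Matrix.fromBlocks
          (tridiag n (fun i => (b i : ℂ)) (offDiag n 0 a) (offDiag n 0 a))
          (tridiag n 0 (branchCoeff n a) (-branchCoeff n a))
          (-tridiag n 0 (branchCoeff n a) (-branchCoeff n a))
          (-tridiag n (fun i => (b i : ℂ)) (offDiag n 0 a) (offDiag n 0 a)) := by
  ext (⟨i, hi⟩ | ⟨i, hi⟩) (⟨j, hj⟩ | ⟨j, hj⟩) <;>
    simp only [Matrix.submatrix_apply, Matrix.map_apply, DnLax, Matrix.of_apply, foldEquiv_inl,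
      foldEquiv_inr, Matrix.fromBlocks_apply₁₁, Matrix.fromBlocks_apply₁₂,
      Matrix.fromBlocks_apply₂₁, Matrix.fromBlocks_apply₂₂, tridiag, offDiag, branchCoeff,
      Matrix.neg_apply, Pi.neg_apply, Pi.zero_apply, zero_mul, add_zero]
  all_goals simp only [apply_ite Complex.ofReal, Complex.ofReal_neg, Complex.ofReal_zero]
  · grind
  · grind
  · grind
  · grind

lemma KTA_submatrix_foldEquiv {n : ℕ} (hn : 4 ≤ n) (a b : ℕ → ℝ)
    {T F E : Matrix (Fin n) (Fin n) ℂ}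
    (hT : T = tridiag n (fun i => (b i : ℂ)) (offDiag n 0 a) (offDiag n 0 a))
    (hF : F = tridiag n 0 (branchCoeff n a) (-branchCoeff n a))
    (hE : E = cornerCorrection n (a 1) (Real.sqrt 2 * Complex.I) (a (n + 1))) :
    (KTA n a b).submatrix (foldEquiv n) (foldEquiv n)
      = Matrix.fromBlocks (T * T - F * F + E) (T * F - F * T) (T * F - F * T)
          (T * T - F * F + E) := by
  have hsq : ∀ p q, (((DnLax n a b * DnLax n a b) (foldEquiv n p) (foldEquiv n q) : ℝ) : ℂ)
      = Matrix.fromBlocks (T * T - F * F) (T * F - F * T) (T * F - F * T) (T * T - F * F) p q := by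
    intro p q
    have h : ((DnLax n a b * DnLax n a b).map Complex.ofRealHom).submatrix (foldEquiv n)
        (foldEquiv n) = Matrix.fromBlocks (T * T - F * F) (T * F - F * T) (T * F - F * T)
          (T * T - F * F) := by
      rw [Matrix.map_mul, ← Matrix.submatrix_mul_equiv _ _ _ (foldEquiv n)]
      have h' := DnLax_submatrix_foldEquiv hn a b
      rw [← hT, ← hF] at h'
      erw [h']
      rw [Matrix.fromBlocks_multiply]
      congr 1 <;> noncomm_ring
    exact congrArg (fun Z : Matrix (Fin n ⊕ Fin n) (Fin n ⊕ Fin n) ℂ => Z p q) h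
  have hcorner : ∀ i j : Fin n, (T * T - F * F + E) i j
      = if (i : ℕ) = 0 ∧ (j : ℕ) = 0 then
          (((a 1) ^ 2 + (b 1) ^ 2 + (a (n + 1)) ^ 2 + 2 * (a (n + 1)) ^ 4 : ℝ) : ℂ)
        else if (i : ℕ) = 0 ∧ (j : ℕ) = 1 then
          (a 1 : ℂ) * (b 1 + b 2 + (Real.sqrt 2 : ℂ) * Complex.I * (a (n + 1) : ℂ) ^ 2)
        else if (i : ℕ) = 1 ∧ (j : ℕ) = 0 then
          (a 1 : ℂ) * (b 1 + b 2 - (Real.sqrt 2 : ℂ) * Complex.I * (a (n + 1) : ℂ) ^ 2)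
        else (T * T - F * F) i j := by
    have h1 : ¬ n ≤ 1 := by omega
    have h2 : ¬ 1 = n - 1 := by omega
    have h3 : ¬ 0 = n - 1 := by omega
    rintro ⟨i, hi⟩ ⟨j, hj⟩
    rw [hT, hF, hE, tridiag_mul_tridiag (by simp [offDiag]) (by simp [offDiag]),
      tridiag_mul_tridiag (by simp [branchCoeff]; omega) (by simp [branchCoeff]; omega),
      pentadiag_sub, Matrix.add_apply]
    rcases i with _ | _ | i <;> rcases j with _ | _ | j <;>
      simp [cornerCorrection, tridiag, pentadiag, offDiag, branchCoeff, Pi.single_apply, h1, h2, h3]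
    all_goals ring
  ext i j
  rcases i with i | i <;> rcases j with j | j
  · simp only [Matrix.submatrix_apply, KTA, Matrix.of_apply, hsq, foldEquiv_inl,
      Matrix.fromBlocks_apply₁₁, hcorner]
    split_ifs <;> first | omega | rfl
  · simp only [Matrix.submatrix_apply, KTA, Matrix.of_apply, hsq, foldEquiv_inl, foldEquiv_inr,
      Matrix.fromBlocks_apply₁₂]
    rw [if_neg (by omega), if_neg (by omega), if_neg (by omega)]
  · simp only [Matrix.submatrix_apply, KTA, Matrix.of_apply, hsq, foldEquiv_inl, foldEquiv_inr,
      Matrix.fromBlocks_apply₂₁]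
    rw [if_neg (by omega), if_neg (by omega), if_neg (by omega)]
  · simp only [Matrix.submatrix_apply, KTA, Matrix.of_apply, hsq, foldEquiv_inr,
      Matrix.fromBlocks_apply₂₂, hcorner]
    split_ifs <;> first | omega | rfl

lemma trace_KTA_pow {n : ℕ} (hn : 4 ≤ n) (a b : ℕ → ℝ) (k : ℕ) :
    (KTA n a b ^ k).trace
      = ((tridiag n (fun i => (b i : ℂ)) (offDiag n 1 a) (offDiag n (-1) a)
          * tridiag n (fun i => (b i : ℂ)) (offDiag n (-1) a) (offDiag n 1 a)
          + cornerCorrection n (a 1) (Real.sqrt 2 * Complex.I) (a (n + 1))) ^ k).trace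
        + ((tridiag n (fun i => (b i : ℂ)) (offDiag n (-1) a) (offDiag n 1 a)
          * tridiag n (fun i => (b i : ℂ)) (offDiag n 1 a) (offDiag n (-1) a)
          + cornerCorrection n (a 1) (Real.sqrt 2 * Complex.I) (a (n + 1))) ^ k).trace := by
  have hsub : (KTA n a b ^ k).trace
      = ((KTA n a b).submatrix (foldEquiv n) (foldEquiv n) ^ k).trace := by
    have h : ∀ k : ℕ, (KTA n a b).submatrix (foldEquiv n) (foldEquiv n) ^ k
        = (KTA n a b ^ k).submatrix (foldEquiv n) (foldEquiv n) := by
      intro k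
      induction k with
      | zero => simp
      | succ k ih => rw [pow_succ, ih, Matrix.submatrix_mul_equiv, pow_succ]
    rw [h]
    exact ((foldEquiv n).sum_comp fun i => (KTA n a b ^ k) i i).symm
  have hoff : ∀ i, offDiag n (-1) a i = offDiag n 0 a i + branchCoeff n a i
      ∧ offDiag n 1 a i = offDiag n 0 a i - branchCoeff n a i := by
    intro i
    simp only [offDiag, branchCoeff]
    split_ifs <;> first | omega | (push_cast; constructor <;> ring)
  have hU : tridiag n (fun i => (b i : ℂ)) (offDiag n (-1) a) (offDiag n 1 a)
      = tridiag n (fun i => (b i : ℂ)) (offDiag n 0 a) (offDiag n 0 a)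
        + tridiag n 0 (branchCoeff n a) (-branchCoeff n a) := by
    rw [tridiag_add, add_zero, funext fun i => (hoff i).1, funext fun i => (hoff i).2]
    simp only [sub_eq_add_neg]
    rfl
  have hV : tridiag n (fun i => (b i : ℂ)) (offDiag n 1 a) (offDiag n (-1) a)
      = tridiag n (fun i => (b i : ℂ)) (offDiag n 0 a) (offDiag n 0 a)
        - tridiag n 0 (branchCoeff n a) (-branchCoeff n a) := by
    rw [tridiag_sub, sub_zero, funext fun i => (hoff i).1, funext fun i => (hoff i).2,
      sub_neg_eq_add]
    rfl
  rw [hsub, KTA_submatrix_foldEquiv hn a b rfl rfl rfl, trace_fromBlocks_pow, hU, hV]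
  congr 3 <;> noncomm_ring

lemma trace_cornerCorrection {n : ℕ} (hn : 4 ≤ n) (x r c : ℂ) :
    (cornerCorrection n x r c).trace = c ^ 2 + 2 * c ^ 4 := by
  rw [Matrix.trace, Finset.sum_eq_single (⟨0, by omega⟩ : Fin n)]
  · simp [cornerCorrection, tridiag]
  · rintro ⟨i, hi⟩ - h
    have : i ≠ 0 := fun h' => h (by simp [h'])
    simp [cornerCorrection, tridiag, Pi.single_apply, this]
  · simp

lemma trace_KTA {n : ℕ} (hn : 4 ≤ n) (a b : ℕ → ℝ) :
    (KTA n a b).trace = 2 * ((∑ i ∈ Finset.Icc 1 n, (b i) ^ 2 + 2 * ∑ i ∈ Finset.Icc 1 n, (a i) ^ 2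
            + (a (n + 1)) ^ 2 + 2 * (a (n + 1)) ^ 4 : ℝ) : ℂ) := by
  have h := trace_KTA_pow hn a b 1
  simp only [pow_one, Matrix.trace_add, trace_cornerCorrection hn] at h
  rw [h, Matrix.trace_mul_comm (tridiag n _ (offDiag n (-1) a) _),
    tridiag_mul_tridiag (by simp [offDiag]) (by simp [offDiag])]
  have hIcc : ∀ f : ℕ → ℝ, ∑ i ∈ Finset.Icc 1 n, f i = ∑ i ∈ Finset.range n, f (i + 1) := by
    intro f
    rw [← Finset.Ico_add_one_right_eq_Icc, Finset.sum_Ico_eq_sum_range]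
    simp [add_comm]
  simp only [Matrix.trace, Matrix.diag_apply, pentadiag, Matrix.of_apply, if_true, hIcc,
    add_tsub_cancel_right]
  rw [Fin.sum_univ_eq_sum_range (fun i : ℕ => (b (i + 1) : ℂ) * b (i + 1)
    + offDiag n 1 a (i + 1) * offDiag n 1 a (i + 1) + offDiag n (-1) a i * offDiag n (-1) a i),
    Finset.sum_add_distrib, Finset.sum_add_distrib]
  obtain ⟨p, rfl⟩ : ∃ p, n = p + 2 := ⟨n - 2, by omega⟩
  have h1 : ∀ ε : ℝ, ∑ i ∈ Finset.range (p + 1), offDiag (p + 2) ε a (i + 1)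
      * offDiag (p + 2) ε a (i + 1)
      = ∑ i ∈ Finset.range p, (a (i + 1) : ℂ) ^ 2 + ((a (p + 1) : ℂ) + ε * a (p + 2)) ^ 2 := by
    intro ε
    rw [Finset.sum_range_succ]
    congr 1
    · refine Finset.sum_congr rfl fun i hi => ?_
      have := Finset.mem_range.1 hi
      simp only [offDiag]
      rw [if_neg (by omega), if_neg (by omega), sq]
    · simp [offDiag, sq]
  rw [Finset.sum_range_succ (fun i => offDiag (p + 2) 1 a (i + 1) * _),
    Finset.sum_range_succ' (fun i => offDiag (p + 2) (-1) a i * _), h1, h1,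
    Finset.sum_range_succ (fun i => a (i + 1) ^ 2), Finset.sum_range_succ (fun i => a (i + 1) ^ 2)]
  simp only [offDiag, ← sq]
  push_cast
  simp
  ring

/-- Along any differentiable solution of the Kozlov–Treshchev system in
Flaschka variables (`n ≥ 4`), the functions `h_{2k}(t) = ½Tr(A(t)^k)` are constant in `t`
for each `k = 1, …, n`; in particular
`h_2 = ½Tr(A) = Σ_{i=1}^n b_i² + 2Σ_{i=1}^n a_i² + a_{n+1}² + 2a_{n+1}⁴`
is a constant of motion. -/
theorem KT_trace_integrals (n : ℕ) (hn : 4 ≤ n)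
    (a b : ℝ → ℕ → ℝ)
    (ha : ∀ (t : ℝ), ∀ i ∈ Finset.Icc 1 (n - 1),
      HasDerivAt (fun s => a s i) (a t i * (b t (i + 1) - b t i)) t)
    (han : ∀ t : ℝ, HasDerivAt (fun s => a s n) (-(a t n * (b t (n - 1) + b t n))) t)
    (han1 : ∀ t : ℝ, HasDerivAt (fun s => a s (n + 1)) (a t (n + 1) * b t 1) t)
    (hb1 : ∀ t : ℝ, HasDerivAt (fun s => b s 1)
      (2 * (a t 1) ^ 2 - (a t (n + 1)) ^ 2 - 4 * (a t (n + 1)) ^ 4) t)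
    (hb : ∀ (t : ℝ), ∀ i ∈ Finset.Icc 2 (n - 2),
      HasDerivAt (fun s => b s i) (2 * ((a t i) ^ 2 - (a t (i - 1)) ^ 2)) t)
    (hbn : ∀ t : ℝ, HasDerivAt (fun s => b s n) (2 * ((a t n) ^ 2 - (a t (n - 1)) ^ 2)) t)
    (hbn1 : ∀ t : ℝ, HasDerivAt (fun s => b s (n - 1))
      (2 * ((a t n) ^ 2 + (a t (n - 1)) ^ 2 - (a t (n - 2)) ^ 2)) t) :
    (∀ k ∈ Finset.Icc 1 n, ∀ t : ℝ,
      (1 / 2 : ℂ) * Matrix.trace (KTA n (a t) (b t) ^ k)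
        = (1 / 2 : ℂ) * Matrix.trace (KTA n (a 0) (b 0) ^ k)) ∧
    (∀ t : ℝ, (1 / 2 : ℂ) * Matrix.trace (KTA n (a t) (b t))
        = ((∑ i ∈ Finset.Icc 1 n, (b t i) ^ 2 + 2 * ∑ i ∈ Finset.Icc 1 n, (a t i) ^ 2
            + (a t (n + 1)) ^ 2 + 2 * (a t (n + 1)) ^ 4 : ℝ) : ℂ)) := by
  have hconst : ∀ ε : ℝ, ε ^ 2 = 1 → ∀ (k : ℕ) (t : ℝ),
      ((tridiag n (fun i => (b t i : ℂ)) (offDiag n ε (a t)) (offDiag n (-ε) (a t))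
          * tridiag n (fun i => (b t i : ℂ)) (offDiag n (-ε) (a t)) (offDiag n ε (a t))
          + cornerCorrection n (a t 1) (Real.sqrt 2 * Complex.I) (a t (n + 1))) ^ k).trace
        = ((tridiag n (fun i => (b 0 i : ℂ)) (offDiag n ε (a 0)) (offDiag n (-ε) (a 0))
          * tridiag n (fun i => (b 0 i : ℂ)) (offDiag n (-ε) (a 0)) (offDiag n ε (a 0))
          + cornerCorrection n (a 0 1) (Real.sqrt 2 * Complex.I) (a 0 (n + 1))) ^ k).trace := by
    intro ε hε k t
    have hoff1 : ∀ t, offDiag n (-ε) (a t) 1 = (a t 1 : ℂ) := by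
      intro t
      rw [offDiag, if_neg (by omega), if_neg (by omega)]
    have hr : ((Real.sqrt 2 : ℂ) * Complex.I) ^ 2 = -2 := by
      rw [mul_pow, Complex.I_sq, ← Complex.ofReal_pow, Real.sq_sqrt (by norm_num)]
      push_cast
      ring
    have hoff : ∀ δ : ℝ, ∀ t i, i + 1 < n →
        HasDerivAt (fun s => offDiag n δ (a s) (i + 1))
          (offDiag n (-δ) (a t) (i + 1) * (b t (i + 2) : ℂ)
            - (b t (i + 1) : ℂ) * offDiag n δ (a t) (i + 1)) t := by
      intro δ t i hi
      simp only [offDiag]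
      have hai := ha t (i + 1) (Finset.mem_Icc.2 (by omega))
      by_cases h : i + 1 = n - 1
      · have h' : i + 2 = n := by omega
        simp only [if_pos h, show ¬ (i + 1 = 0 ∨ n ≤ i + 1) by omega, if_false]
        refine (hai.fun_add ((han t).const_mul δ)).ofReal_comp.congr_deriv ?_
        rw [← h, ← h']
        push_cast
        ring
      · simp only [if_neg h, show ¬ (i + 1 = 0 ∨ n ≤ i + 1) by omega, if_false]
        refine hai.ofReal_comp.congr_deriv ?_
        push_cast
        ring
    have key := trace_pow_tridiag_const hn hr (b := fun t i => (b t i : ℂ))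
      (u := fun t => offDiag n (-ε) (a t)) (l := fun t => offDiag n ε (a t))
      (c := fun t => (a t (n + 1) : ℂ)) (by simp [offDiag]) (by simp [offDiag])
      (by simp [offDiag]) (by simp [offDiag]) ?_ ?_ (fun t i hi => ?_) (hoff ε)
      (fun t => ?_) k t 0
    · simpa only [hoff1] using key
    · intro t i hi
      simp only [offDiag, if_neg hi]
    · intro t i hi
      have hεC : (ε : ℂ) ^ 2 = 1 := by exact_mod_cast hε
      rcases i with _ | i
      · have h1 : offDiag n ε (a t) 1 = (a t 1 : ℂ) := by
          rw [offDiag, if_neg (by omega), if_neg (by omega)]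
        simp only [zero_add, hoff1, h1, Pi.single_eq_same]
        refine (hb1 t).ofReal_comp.congr_deriv ?_
        simp only [offDiag]
        push_cast
        simp
        ring
      · rw [Pi.single_eq_of_ne (by omega), add_zero]
        obtain h | h | h : i + 2 = n ∨ i + 2 = n - 1 ∨ i + 2 ≤ n - 2 := by omega
        · subst h
          refine (hbn t).ofReal_comp.congr_deriv ?_
          simp [offDiag]
          linear_combination (-2 * (a t (i + 2) : ℂ) ^ 2) * hεC
        · obtain rfl : n = i + 3 := by omega
          refine (hbn1 t).ofReal_comp.congr_deriv ?_
          simp [offDiag]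
          linear_combination (-2 * (a t (i + 3) : ℂ) ^ 2) * hεC
        · refine (hb t (i + 2) (Finset.mem_Icc.2 (by omega))).ofReal_comp.congr_deriv ?_
          simp only [offDiag, show ¬ (i + 1 + 1 = 0 ∨ n ≤ i + 1 + 1) by omega,
            show ¬ (i + 1 + 1 = n - 1) by omega, show ¬ (i + 1 = 0 ∨ n ≤ i + 1) by omega,
            show ¬ (i + 1 = n - 1) by omega, if_false]
          push_cast
          ring
    · simpa using hoff (-ε) t i hi
    · simpa using (han1 t).ofReal_comp
  refine ⟨fun k _ t => ?_, fun t => ?_⟩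
  · rw [trace_KTA_pow hn, trace_KTA_pow hn]
    have h1 := hconst 1 (by norm_num) k t
    have h2 := hconst (-1) (by norm_num) k t
    rw [neg_neg] at h2
    rw [h1, h2]
  · rw [trace_KTA hn, ← mul_assoc]
    norm_num
end
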